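/- Define, over all Schwartz functions v : ℝ^{N+1} → ℝ with ∫_{ℝ^N} |v(x,0)|^{2*} dx > 0, the two infima S = inf [ ∬_{ℝ^{N+1}_+} |∇v|² dx dy / (∫_{ℝ^N} |v(x,0)|^{2*} dx)^{2/2*} ] and Λ = inf [ ∬_{ℝ^{N+1}_+} (|∇v|² + |x|² v²) dx dy / (∫_{ℝ^N} |v(x,0)|^{2*} dx)^{2/2*} ]. Then Λ = S. -/

import Mathlib

open MeasureTheory

noncomputable section

/-- `ℝ^N` as a Euclidean space. -/
abbrev RN (N : ℕ) := EuclideanSpace ℝ (Fin N)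

/-- `ℝ^{N+1}`, with points written `(x, y)`, `x ∈ ℝ^N`, `y ∈ ℝ`. -/
abbrev RN1 (N : ℕ) := RN N × ℝ

/-- The upper half-space `{(x,y) : y > 0}`. -/
def upperHalf (N : ℕ) : Set (RN1 N) := {p | 0 < p.2}

/-- The `i`-th horizontal coordinate direction in `ℝ^{N+1}`. -/
def dirX (N : ℕ) (i : Fin N) : RN1 N := (EuclideanSpace.single i 1, 0)

/-- The vertical coordinate direction in `ℝ^{N+1}`. -/
def dirY (N : ℕ) : RN1 N := (0, 1)

/-- `|∇v|²`, the squared norm of the full gradient of `v` at `p`. -/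
def gradSq (N : ℕ) (v : RN1 N → ℝ) (p : RN1 N) : ℝ :=
  (∑ i : Fin N, (fderiv ℝ v p (dirX N i)) ^ 2) + (fderiv ℝ v p (dirY N)) ^ 2

/-- The Laplacian of `v` at `p` (sum of pure second derivatives). -/
def lap (N : ℕ) (v : RN1 N → ℝ) (p : RN1 N) : ℝ :=
  (∑ i : Fin N, fderiv ℝ (fun q => fderiv ℝ v q (dirX N i)) p (dirX N i)) +
    fderiv ℝ (fun q => fderiv ℝ v q (dirY N)) p (dirY N)

/-- The critical exponent `2* = 2N/(N-1)`. -/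
def twoStar (N : ℕ) : ℝ := 2 * N / (N - 1)

open scoped LineDeriv Pointwise

instance isAddHaarMeasure_volume_RN1 (N : ℕ) :
    (volume : Measure (RN1 N)).IsAddHaarMeasure :=
  inferInstanceAs ((volume : Measure (RN N)).prod (volume : Measure ℝ)).IsAddHaarMeasure

theorem gradSq_integrable {N : ℕ} (v : SchwartzMap (RN1 N) ℝ) :
    Integrable (fun p => gradSq N v p) := by
  have h : ∀ m : RN1 N, Integrable (fun p => (fderiv ℝ v p m) ^ 2) := fun m => by
    have := ((∂_{m} v : SchwartzMap (RN1 N) ℝ).memLp 2 volume).integrable_sq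
    simpa [SchwartzMap.lineDerivOp_apply_eq_fderiv] using this
  exact (integrable_finsetSum _ fun i _ => h _).add (h _)

theorem norm_fst_sq_mul_sq_integrable {N : ℕ} (v : SchwartzMap (RN1 N) ℝ) :
    Integrable (fun p : RN1 N => ‖p.1‖ ^ 2 * (v p) ^ 2) := by
  have hv : Continuous v := v.continuous
  refine ((v.integrable_pow_mul volume 2).mul_const (SchwartzMap.seminorm ℝ 0 0 v)).mono'
    (by fun_prop) (.of_forall fun p => ?_)
  have h1 : ‖p.1‖ ≤ ‖p‖ := norm_fst_le p
  have h2 : ‖v p‖ ≤ SchwartzMap.seminorm ℝ 0 0 v := SchwartzMap.norm_le_seminorm ℝ v p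
  rw [Real.norm_of_nonneg (by positivity), ← sq_abs (v p), ← Real.norm_eq_abs, sq ‖v p‖,
    ← mul_assoc]
  gcongr

theorem gradSq_nonneg {N : ℕ} (v : RN1 N → ℝ) (p : RN1 N) : 0 ≤ gradSq N v p := by
  unfold gradSq; positivity

/-- The dilation `p ↦ v (t • p)` of a Schwartz function. -/
def dilate {N : ℕ} (v : SchwartzMap (RN1 N) ℝ) (t : ℝˣ) : SchwartzMap (RN1 N) ℝ :=
  SchwartzMap.compCLMOfContinuousLinearEquiv ℝ (ContinuousLinearEquiv.smulLeft t) v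

theorem dilate_apply {N : ℕ} (v : SchwartzMap (RN1 N) ℝ) (t : ℝˣ) (p : RN1 N) :
    dilate v t p = v ((t : ℝ) • p) := rfl

theorem gradSq_dilate {N : ℕ} (v : SchwartzMap (RN1 N) ℝ) (t : ℝˣ) (p : RN1 N) :
    gradSq N (dilate v t) p = (t : ℝ) ^ 2 * gradSq N v ((t : ℝ) • p) := by
  have h : fderiv ℝ (dilate v t) p = (t : ℝ) • fderiv ℝ v ((t : ℝ) • p) :=
    fderiv_comp_smul (f := v) (t : ℝ)
  simp only [gradSq, h, smul_apply, smul_eq_mul, mul_pow, mul_add,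
    Finset.mul_sum]

theorem setIntegral_upperHalf_comp_smul {N : ℕ} (f : RN1 N → ℝ) {t : ℝ} (ht : 0 < t) :
    ∫ p in upperHalf N, f (t • p) = (t ^ (N + 1))⁻¹ * ∫ p in upperHalf N, f p := by
  have hset : t • upperHalf N = upperHalf N := by
    ext p
    rw [Set.mem_smul_set_iff_inv_smul_mem₀ ht.ne']
    simp [upperHalf, ht]
  have hfin : Module.finrank ℝ (RN1 N) = N + 1 := by simp
  rw [Measure.setIntegral_comp_smul_of_pos _ f (upperHalf N) ht, hset, hfin, smul_eq_mul]

theorem setIntegral_gradSq_dilate {N : ℕ} (v : SchwartzMap (RN1 N) ℝ) {t : ℝˣ}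
    (ht : 0 < (t : ℝ)) :
    ∫ p in upperHalf N, gradSq N (dilate v t) p =
      (t : ℝ) ^ 2 * (((t : ℝ) ^ (N + 1))⁻¹ * ∫ p in upperHalf N, gradSq N v p) := by
  simp_rw [gradSq_dilate]
  rw [integral_const_mul, setIntegral_upperHalf_comp_smul _ ht]

theorem setIntegral_norm_fst_sq_mul_sq_dilate {N : ℕ} (v : SchwartzMap (RN1 N) ℝ) {t : ℝˣ}
    (ht : 0 < (t : ℝ)) :
    ∫ p in upperHalf N, ‖p.1‖ ^ 2 * (dilate v t p) ^ 2 =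
      ((t : ℝ) ^ 2)⁻¹ *
        (((t : ℝ) ^ (N + 1))⁻¹ * ∫ p in upperHalf N, ‖p.1‖ ^ 2 * (v p) ^ 2) := by
  rw [← setIntegral_upperHalf_comp_smul (fun p => ‖p.1‖ ^ 2 * (v p) ^ 2) ht,
    ← integral_const_mul]
  congr 1 with p
  rw [dilate_apply, Prod.smul_fst, norm_smul, Real.norm_of_nonneg ht.le]
  field_simp

theorem integral_trace_dilate {N : ℕ} (v : SchwartzMap (RN1 N) ℝ) {t : ℝˣ}
    (ht : 0 < (t : ℝ)) (q : ℝ) :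
    ∫ x : RN N, |dilate v t (x, 0)| ^ q =
      ((t : ℝ) ^ N)⁻¹ * ∫ x : RN N, |v (x, 0)| ^ q := by
  have := Measure.integral_comp_smul_of_nonneg (volume : Measure (RN N))
    (fun x => |v (x, 0)| ^ q) t (hR := ht.le)
  simpa [dilate_apply] using this

/-- At the exponent `2 / 2*`, the trace term scales like the Dirichlet energy. -/
theorem inv_pow_mul_rpow_two_div_twoStar {N : ℕ} (hN : 2 ≤ N) {t b : ℝ} (ht : 0 < t)
    (hb : 0 < b) :
    ((t ^ N)⁻¹ * b) ^ (2 / twoStar N) = t ^ 2 * (t ^ (N + 1))⁻¹ * b ^ (2 / twoStar N) := by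
  have hN' : (2 : ℝ) ≤ N := by exact_mod_cast hN
  have he : (N : ℝ) * (2 / twoStar N) = N - 1 := by
    have : (N : ℝ) - 1 ≠ 0 := by linarith
    unfold twoStar
    field_simp
  rw [Real.mul_rpow (by positivity) hb.le, Real.inv_rpow (by positivity), ← Real.rpow_natCast t N,
    ← Real.rpow_mul ht.le, he, Real.rpow_sub_one ht.ne', Real.rpow_natCast]
  congr 1
  field_simp
  ring

theorem dilate_quotient {N : ℕ} (hN : 2 ≤ N) (v : SchwartzMap (RN1 N) ℝ)
    (hv : 0 < ∫ x : RN N, |v (x, 0)| ^ twoStar N) {t : ℝˣ} (ht : 0 < (t : ℝ)) :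
    (∫ p in upperHalf N, (gradSq N (dilate v t) p + ‖p.1‖ ^ 2 * (dilate v t p) ^ 2)) /
        (∫ x : RN N, |dilate v t (x, 0)| ^ twoStar N) ^ (2 / twoStar N) =
      (∫ p in upperHalf N, gradSq N v p) /
          (∫ x : RN N, |v (x, 0)| ^ twoStar N) ^ (2 / twoStar N) +
        ((t : ℝ) ^ 4)⁻¹ * ((∫ p in upperHalf N, ‖p.1‖ ^ 2 * (v p) ^ 2) /
          (∫ x : RN N, |v (x, 0)| ^ twoStar N) ^ (2 / twoStar N)) := by
  rw [integral_add (gradSq_integrable _).integrableOn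
      (norm_fst_sq_mul_sq_integrable _).integrableOn,
    setIntegral_gradSq_dilate v ht, setIntegral_norm_fst_sq_mul_sq_dilate v ht,
    integral_trace_dilate v ht, inv_pow_mul_rpow_two_div_twoStar hN ht hv]
  have := Real.rpow_pos_of_pos hv (2 / twoStar N)
  field_simp

theorem stmt8 (N : ℕ) (hN : 2 ≤ N) :
    sInf {r : ℝ | ∃ v : SchwartzMap (RN1 N) ℝ,
        0 < (∫ x : RN N, |v (x, 0)| ^ twoStar N) ∧
        r = (∫ p in upperHalf N, (gradSq N v p + ‖p.1‖ ^ 2 * (v p) ^ 2)) /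
              (∫ x : RN N, |v (x, 0)| ^ twoStar N) ^ (2 / twoStar N)} =
    sInf {r : ℝ | ∃ v : SchwartzMap (RN1 N) ℝ,
        0 < (∫ x : RN N, |v (x, 0)| ^ twoStar N) ∧
        r = (∫ p in upperHalf N, gradSq N v p) /
              (∫ x : RN N, |v (x, 0)| ^ twoStar N) ^ (2 / twoStar N)} := by
  have hbdd : ∀ s : Set ℝ, (∀ r ∈ s, 0 ≤ r) → BddBelow s := fun s hs => ⟨0, hs⟩
  have hden (v : SchwartzMap (RN1 N) ℝ) (hv : 0 < ∫ x : RN N, |v (x, 0)| ^ twoStar N) :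
      0 < (∫ x : RN N, |v (x, 0)| ^ twoStar N) ^ (2 / twoStar N) := Real.rpow_pos_of_pos hv _
  by_cases hne : ∃ v : SchwartzMap (RN1 N) ℝ, 0 < ∫ x : RN N, |v (x, 0)| ^ twoStar N
  swap
  · push Not at hne
    congr 1
    ext r
    constructor <;> rintro ⟨v, hv, -⟩ <;> exact absurd hv (hne v).not_gt
  obtain ⟨v₀, hv₀⟩ := hne
  apply le_antisymm
  · refine le_csInf ⟨_, v₀, hv₀, rfl⟩ ?_
    rintro _ ⟨v, hv, rfl⟩
    set K := (∫ p in upperHalf N, ‖p.1‖ ^ 2 * (v p) ^ 2) /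
      (∫ x : RN N, |v (x, 0)| ^ twoStar N) ^ (2 / twoStar N)
    set G := (∫ p in upperHalf N, gradSq N v p) /
      (∫ x : RN N, |v (x, 0)| ^ twoStar N) ^ (2 / twoStar N)
    have hlim : Filter.Tendsto (fun t : ℝ => G + (t ^ 4)⁻¹ * K) Filter.atTop (nhds G) := by
      simpa using (((Filter.tendsto_pow_atTop (α := ℝ) (n := 4) (by norm_num)).inv_tendsto_atTop
        ).mul_const K).const_add G
    refine ge_of_tendsto hlim ?_
    filter_upwards [Filter.eventually_gt_atTop (0 : ℝ)] with t ht
    refine csInf_le (hbdd _ ?_) ⟨dilate v (Units.mk0 t ht.ne'), ?_, ?_⟩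
    · rintro _ ⟨w, hw, rfl⟩
      exact div_nonneg (integral_nonneg fun p => add_nonneg (gradSq_nonneg _ _) (by positivity))
        (hden w hw).le
    · rw [integral_trace_dilate v (t := Units.mk0 t ht.ne') ht]
      exact mul_pos (inv_pos.2 (pow_pos ht _)) hv
    · exact (dilate_quotient hN v hv (t := Units.mk0 t ht.ne') ht).symm
  · refine le_csInf ⟨_, v₀, hv₀, rfl⟩ ?_
    rintro _ ⟨v, hv, rfl⟩
    refine le_trans (csInf_le (hbdd _ ?_) ⟨v, hv, rfl⟩) ?_
    · rintro _ ⟨w, hw, rfl⟩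
      exact div_nonneg (integral_nonneg fun p => gradSq_nonneg _ _) (hden w hw).le
    · refine div_le_div_of_nonneg_right ?_ (hden v hv).le
      exact integral_mono (gradSq_integrable v).integrableOn
        ((gradSq_integrable v).add (norm_fst_sq_mul_sq_integrable v)).integrableOn
        fun p => le_add_of_nonneg_right (by positivity)
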